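/- Let φ = ⟨φ_T, φ_P, φ_ℓ⟩ : N → N' be a morphism of safe nets and let m be a marking of N reachable from the initial marking by a firing sequence all of whose transitions have a defined image under φ_T. Then φ_P(m) = {p' ∈ P' | ∃ p ∈ m, p φ_P p'} is a reachable marking of N'. -/

import Mathlib

attribute [local instance] Classical.propDecidable

noncomputable section

/-- A labeled Petri net with places `P`, transitions `T` and label alphabet `L`. -/
structure PetriNet (P T L : Type) where
  flowPT : P → T → Prop
  flowTP : T → P → Prop
  init : P → ℕ
  labelP : P → L
  labelT : T → L

namespace PetriNet

variable {P T L : Type}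

/-- Presets and postsets of transitions are assumed nonempty. -/
def Proper (N : PetriNet P T L) : Prop :=
  ∀ t : T, (∃ p, N.flowPT p t) ∧ (∃ p, N.flowTP t p)

/-- A transition is enabled at a marking if the marking contains its preset. -/
def Enabled (N : PetriNet P T L) (m : P → ℕ) (t : T) : Prop :=
  ∀ p, N.flowPT p t → 1 ≤ m p

/-- The marking obtained by firing `t` at `m`: `m' = m - •t + t•`. -/
def fire (N : PetriNet P T L) (m : P → ℕ) (t : T) : P → ℕ :=
  fun p => m p - (if N.flowPT p t then 1 else 0) + (if N.flowTP t p then 1 else 0)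

/-- `m →t m'`. -/
def Fires (N : PetriNet P T L) (m : P → ℕ) (t : T) (m' : P → ℕ) : Prop :=
  N.Enabled m t ∧ m' = N.fire m t

inductive ReachableFrom (N : PetriNet P T L) : (P → ℕ) → (P → ℕ) → Prop
  | refl (m : P → ℕ) : ReachableFrom N m m
  | step {m₁ m₂ m₃ : P → ℕ} (t : T) :
      ReachableFrom N m₁ m₂ → N.Fires m₂ t m₃ → ReachableFrom N m₁ m₃

def Reachable (N : PetriNet P T L) (m : P → ℕ) : Prop :=
  N.ReachableFrom N.init m

/-- A net is safe if every reachable marking takes values in `{0,1}`. -/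
def Safe (N : PetriNet P T L) : Prop :=
  ∀ m, N.Reachable m → ∀ p, m p ≤ 1

end PetriNet

/-- The data of a (partial) morphism between labeled nets:
a partial map on transitions, a relation on places and a map on labels. -/
structure NetMap (P T L P' T' L' : Type) where
  φT : T → Option T'
  φP : P → P' → Prop
  φl : L → L'

/-- The morphism conditions for safe labeled nets. -/
structure IsMorphism {P T L P' T' L' : Type} (N : PetriNet P T L) (N' : PetriNet P' T' L')
    (f : NetMap P T L P' T' L') : Prop where
  init_unique : ∀ p', N'.init p' = 1 → ∃! p, N.init p = 1 ∧ f.φP p p'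
  pre_place : ∀ p p', f.φP p p' → ∀ t, N.flowTP t p → ∃ t', f.φT t = some t' ∧ N'.flowTP t' p'
  post_place : ∀ p p', f.φP p p' → ∀ t, N.flowPT p t → ∃ t', f.φT t = some t' ∧ N'.flowPT p' t'
  pre_trans : ∀ t t', f.φT t = some t' → ∀ p', N'.flowPT p' t' → ∃! p, N.flowPT p t ∧ f.φP p p'
  post_trans : ∀ t t', f.φT t = some t' → ∀ p', N'.flowTP t' p' → ∃! p, N.flowTP t p ∧ f.φP p p'
  label_trans : ∀ t t', f.φT t = some t' → N'.labelT t' = f.φl (N.labelT t)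
  label_place : ∀ p p', f.φP p p' → N'.labelP p' = f.φl (N.labelP p)

/-- Componentwise composition of net maps. -/
def NetMap.comp {P T L P' T' L' P'' T'' L'' : Type}
    (f : NetMap P T L P' T' L') (g : NetMap P' T' L' P'' T'' L'') :
    NetMap P T L P'' T'' L'' where
  φT := fun t => (f.φT t).bind g.φT
  φP := Relation.Comp f.φP g.φP
  φl := g.φl ∘ f.φl

/-- The identity net map. -/
def idNetMap (P T L : Type) : NetMap P T L P T L where
  φT := fun t => some t
  φP := Eq
  φl := id

/-- The image `φ_P(m) = {p' | ∃ p ∈ m, p φ_P p'}` of a (safe) marking. -/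
def imageMarking {P P' : Type} (φP : P → P' → Prop) (m : P → ℕ) : P' → ℕ :=
  fun p' => if ∃ p, 1 ≤ m p ∧ φP p p' then 1 else 0

/-- A multi-clock net: a safe net with a partition `ν` of places into components
indexed by `ι`; `ι₀ i` is the initial place of component `i`. -/
structure MCNet (P T L ι : Type) where
  net : PetriNet P T L
  ν : P → ι
  ι₀ : ι → P

structure IsMCNet {P T L ι : Type} (M : MCNet P T L ι) : Prop where
  safe : M.net.Safe
  proper : M.net.Proper
  init_mem : ∀ i, M.net.init (M.ι₀ i) = 1
  nu_iota : ∀ i, M.ν (M.ι₀ i) = i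
  iota_nu : ∀ p, M.net.init p = 1 → M.ι₀ (M.ν p) = p
  inj_pre : ∀ t p q, M.net.flowPT p t → M.net.flowPT q t → M.ν p = M.ν q → p = q
  inj_post : ∀ t p q, M.net.flowTP t p → M.net.flowTP t q → M.ν p = M.ν q → p = q
  pre_eq_post : ∀ t i, (∃ p, M.net.flowPT p t ∧ M.ν p = i) ↔ (∃ p, M.net.flowTP t p ∧ M.ν p = i)

/-- A morphism of multi-clock nets: a safe-net morphism preserving the partitions,
i.e. `p φ_P p'` implies `ν(p) φ_P ν'(p')`. -/
def IsMCNMorphism {P T L ι P' T' L' ι' : Type}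
    (M : MCNet P T L ι) (M' : MCNet P' T' L' ι')
    (f : NetMap P T L P' T' L') : Prop :=
  IsMorphism M.net M'.net f ∧
    ∀ p p', f.φP p p' → f.φP (M.ι₀ (M.ν p)) (M'.ι₀ (M'.ν p'))

/-- `t` belongs to the `i`-th component (has a pre-place and a post-place there). -/
def inComponent {P T L ι : Type} (M : MCNet P T L ι) (i : ι) (t : T) : Prop :=
  (∃ p, M.net.flowPT p t ∧ M.ν p = i) ∧ (∃ p, M.net.flowTP t p ∧ M.ν p = i)

/-- A folding morphism of multi-clock nets: a total mcn-morphism such that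
transitions with equal presets and equal images coincide. -/
def IsFolding {P T L ι P' T' L' ι' : Type}
    (M : MCNet P T L ι) (M' : MCNet P' T' L' ι') (f : NetMap P T L P' T' L') : Prop :=
  IsMCNMorphism M M' f ∧ (∀ t, (f.φT t).isSome) ∧ (∀ p, ∃ p', f.φP p p') ∧
    ∀ t t', (∀ p, M.net.flowPT p t ↔ M.net.flowPT p t') → f.φT t = f.φT t' → t = t'

/-- The suffix-stable equivalence relation generated by a set of equations `E` on words. -/
inductive TickRel {A : Type} (E : List A → List A → Prop) : List A → List A → Prop
  | of {u v : List A} : E u v → TickRel E u v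
  | refl (u : List A) : TickRel E u u
  | symm {u v : List A} : TickRel E u v → TickRel E v u
  | trans {u v w : List A} : TickRel E u v → TickRel E v w → TickRel E u w
  | ext {u v : List A} (w : List A) : TickRel E u v → TickRel E (u ++ w) (v ++ w)

def tickSetoid {A : Type} (E : List A → List A → Prop) : Setoid (List A) :=
  ⟨TickRel E, ⟨fun u => TickRel.refl u, fun h => h.symm, fun h h' => h.trans h'⟩⟩

/-- The ticking domain generated by the equations `E`: `A*/∼_E`. -/
abbrev Tick {A : Type} (E : List A → List A → Prop) : Type :=
  Quotient (tickSetoid E)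

/-- The equivalence class `[u]` of a word. -/
abbrev Tick.mk {A : Type} (E : List A → List A → Prop) (u : List A) : Tick E :=
  Quotient.mk (tickSetoid E) u

/-- Right concatenation descends to the ticking domain: `[u] v = [u v]`. -/
def Tick.append {A : Type} {E : List A → List A → Prop} (x : Tick E) (w : List A) : Tick E :=
  Quot.lift (fun u => Tick.mk E (u ++ w))
    (fun u v (h : TickRel E u v) => Quot.sound (TickRel.ext w h)) x

/-- The canonical `op_J^k` operations (Definition 4.1): the `i`-th entry of the mix
is the `i`-th entry of `α i` if `i ∈ J`, and of `α k` otherwise. -/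
def opJK {ι : Type} {D : ι → Type} (J : Set ι) (k : ι) (α : ι → ∀ i, D i) : ∀ i, D i :=
  fun i => if i ∈ J then α i i else α k i

/-- A multi-clock net whose places are annotated with vector clocks in `∀ i, D i`. -/
structure SpreadNet (P T L ι : Type) (D : ι → Type) where
  M : MCNet P T L ι
  h : P → ∀ i, D i

/-- The spread-net conditions with respect to `op` operations, the all-ε vector
clock `ε` and ticking mappings `τ`. -/
structure IsSpreadNet {P T L ι : Type} {D : ι → Type}
    (op : Set ι → ι → (ι → ∀ i, D i) → ∀ i, D i)
    (S : SpreadNet P T L ι D) (ε : ∀ i, D i)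
    (τ : ι → (∀ i, D i) → T → ∀ i, D i) : Prop where
  mcnet : IsMCNet S.M
  h_init : ∀ p, S.M.net.init p = 1 → S.h p = ε
  h_inj : ∀ p p', S.M.net.labelP p = S.M.net.labelP p' → S.h p = S.h p' → p = p'
  h_tick : ∀ t p, S.M.net.flowTP t p →
    ∃ α : ι → ∀ i, D i, (∀ q, S.M.net.flowPT q t → α (S.M.ν q) = S.h q) ∧
      S.h p = τ (S.M.ν p) (op (S.M.ν '' {q | S.M.net.flowPT q t}) (S.M.ν p) α) t

/-- A spread-morphism: an mcn-morphism of supports together with a map of vector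
clock domains commuting with the ticking mappings and the annotations. -/
structure IsSpreadMorphism {P T L ι P' T' L' : Type} {D D' : ι → Type}
    (S : SpreadNet P T L ι D) (τ : ι → (∀ i, D i) → T → ∀ i, D i)
    (S' : SpreadNet P' T' L' ι D') (τ' : ι → (∀ i, D' i) → T' → ∀ i, D' i)
    (f : NetMap P T L P' T' L') (δ : (∀ i, D i) → ∀ i, D' i) : Prop where
  mcn : IsMCNMorphism S.M S'.M f
  tick : ∀ i t t', f.φT t = some t' → inComponent S.M i t →
    ∀ α, τ' i (δ α) t' = δ (τ i α t)
  ann : ∀ p p', f.φP p p' → δ (S.h p) = S'.h p'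

/-- Isomorphism of multi-clock nets. -/
def MCNIso {P T L ι P' T' L' : Type}
    (M : MCNet P T L ι) (M' : MCNet P' T' L' ι) : Prop :=
  ∃ (f : NetMap P T L P' T' L') (g : NetMap P' T' L' P T L),
    IsMCNMorphism M M' f ∧ IsMCNMorphism M' M g ∧
      f.comp g = idNetMap P T L ∧ g.comp f = idNetMap P' T' L'

/-- `s` belongs to the alphabet `ℓ(T_i)` of the `i`-th component. -/
def InAlph {P T L ι : Type} (M : MCNet P T L ι) (i : ι) (s : L) : Prop :=
  ∃ t, inComponent M i t ∧ M.net.labelT t = s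

/-- The alphabet `ℓ(T_i)` of component `i`, as a subtype of the labels. -/
def Alph {P T L ι : Type} (M : MCNet P T L ι) (i : ι) : Type :=
  {s : L // InAlph M i s}

/-- Projection of a word over `L` onto the alphabet of component `i`. -/
def projAlph {P T L ι : Type} (M : MCNet P T L ι) (i : ι) (w : List L) : List (Alph M i) :=
  w.filterMap (fun s => if h : InAlph M i s then some ⟨s, h⟩ else none)

end

/-- Reachability by a firing sequence all of whose transitions have a defined
image under `φT`. -/
inductive ReachableDef {P T L T' : Type} (N : PetriNet P T L) (φT : T → Option T') :
    (P → ℕ) → Prop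
  | init : ReachableDef N φT N.init
  | step {m m' : P → ℕ} {t : T} :
      ReachableDef N φT m → N.Fires m t m' → (φT t).isSome → ReachableDef N φT m'

/-- A relation between places separates a marking if every place is related to
at most one marked place. -/
def SeparatesMarking {P P' : Type} (φP : P → P' → Prop) (m : P → ℕ) : Prop :=
  ∀ p q p', 1 ≤ m p → 1 ≤ m q → φP p p' → φP q p' → p = q

theorem ReachableDef.reachable {P T L T' : Type} {N : PetriNet P T L} {φT : T → Option T'}
    {m : P → ℕ} (hm : ReachableDef N φT m) : N.Reachable m := by
  induction hm with
  | init => exact .refl _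
  | step _ hfire _ ih => exact .step _ ih hfire

theorem one_le_imageMarking_iff {P P' : Type} {φP : P → P' → Prop} {m : P → ℕ} {p' : P'} :
    1 ≤ imageMarking φP m p' ↔ ∃ p, 1 ≤ m p ∧ φP p p' := by
  unfold imageMarking
  split_ifs with h <;> simp [h]

theorem imageMarking_le_one {P P' : Type} (φP : P → P' → Prop) (m : P → ℕ) (p' : P') :
    imageMarking φP m p' ≤ 1 := by
  unfold imageMarking
  split_ifs <;> simp

namespace PetriNet

variable {P T L : Type} {N : PetriNet P T L} {m : P → ℕ} {t : T} {p : P}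

theorem one_le_fire_of_post (h : N.flowTP t p) : 1 ≤ N.fire m t p := by
  simp [fire, h]

theorem one_le_fire_iff_of_not_post (hm : m p ≤ 1) (h : ¬ N.flowTP t p) :
    1 ≤ N.fire m t p ↔ 1 ≤ m p ∧ ¬ N.flowPT p t := by
  by_cases hpre : N.flowPT p t
  · simp [fire, h, hpre, hm]
  · simp [fire, h, hpre]

/-- If firing keeps the post-places safe, a marked post-place must also be a pre-place. -/
theorem pre_of_post_of_fire_le_one (hle : N.fire m t p ≤ 1) (hm : 1 ≤ m p)
    (h : N.flowTP t p) : N.flowPT p t := by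
  by_contra hpre
  simp only [fire, h, hpre, if_true, if_false] at hle
  omega

end PetriNet

namespace IsMorphism

variable {P T L P' T' L' : Type} {N : PetriNet P T L} {N' : PetriNet P' T' L'}
  {f : NetMap P T L P' T' L'} {m : P → ℕ} {t : T} {t' : T'} {p : P} {p' : P'}

theorem post_of_post (hf : IsMorphism N N' f) (ht : f.φT t = some t') (hp : f.φP p p')
    (h : N.flowTP t p) : N'.flowTP t' p' := by
  obtain ⟨s, hs, hsp⟩ := hf.pre_place p p' hp t h
  rw [ht, Option.some.injEq] at hs
  rwa [hs]

theorem pre_of_pre (hf : IsMorphism N N' f) (ht : f.φT t = some t') (hp : f.φP p p')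
    (h : N.flowPT p t) : N'.flowPT p' t' := by
  obtain ⟨s, hs, hsp⟩ := hf.post_place p p' hp t h
  rw [ht, Option.some.injEq] at hs
  rwa [hs]

theorem enabled_imageMarking (hf : IsMorphism N N' f) (ht : f.φT t = some t')
    (hen : N.Enabled m t) : N'.Enabled (imageMarking f.φP m) t' := by
  intro p' hp'
  obtain ⟨p, ⟨hpt, hpp'⟩, -⟩ := hf.pre_trans t t' ht p' hp'
  exact one_le_imageMarking_iff.2 ⟨p, hen p hpt, hpp'⟩

/-- In a separated marking, a marked place over a pre-place of `t'` is a pre-place of `t`. -/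
theorem pre_of_pre_image (hf : IsMorphism N N' f) (ht : f.φT t = some t')
    (hsep : SeparatesMarking f.φP m) (hen : N.Enabled m t) (hp : f.φP p p') (hmp : 1 ≤ m p)
    (h : N'.flowPT p' t') : N.flowPT p t := by
  obtain ⟨r, ⟨hrt, hrp'⟩, -⟩ := hf.pre_trans t t' ht p' h
  rwa [hsep p r p' hmp (hen r hrt) hp hrp']

theorem imageMarking_fire (hf : IsMorphism N N' f) (ht : f.φT t = some t')
    (hsep : SeparatesMarking f.φP m) (hen : N.Enabled m t) (hm : ∀ p, m p ≤ 1)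
    (hsafe : ∀ p', N'.fire (imageMarking f.φP m) t' p' ≤ 1) :
    imageMarking f.φP (N.fire m t) = N'.fire (imageMarking f.φP m) t' := by
  funext p'
  suffices h : 1 ≤ imageMarking f.φP (N.fire m t) p' ↔
      1 ≤ N'.fire (imageMarking f.φP m) t' p' by
    have h₁ := imageMarking_le_one f.φP (N.fire m t) p'
    have h₂ := hsafe p'
    omega
  by_cases hpost : N'.flowTP t' p'
  · obtain ⟨p, ⟨htp, hpp'⟩, -⟩ := hf.post_trans t t' ht p' hpost
    exact iff_of_true
      (one_le_imageMarking_iff.2 ⟨p, PetriNet.one_le_fire_of_post htp, hpp'⟩)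
      (PetriNet.one_le_fire_of_post hpost)
  · rw [PetriNet.one_le_fire_iff_of_not_post (imageMarking_le_one _ _ _) hpost,
      one_le_imageMarking_iff, one_le_imageMarking_iff]
    have key (p : P) (hp : f.φP p p') : 1 ≤ N.fire m t p ↔ 1 ≤ m p ∧ ¬ N.flowPT p t :=
      PetriNet.one_le_fire_iff_of_not_post (hm p) fun h => hpost (hf.post_of_post ht hp h)
    constructor
    · rintro ⟨p, hmp, hp⟩
      obtain ⟨hmp, hpre⟩ := (key p hp).1 hmp
      exact ⟨⟨p, hmp, hp⟩, fun h => hpre (hf.pre_of_pre_image ht hsep hen hp hmp h)⟩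
    · rintro ⟨⟨p, hmp, hp⟩, hpre⟩
      exact ⟨p, (key p hp).2 ⟨hmp, fun h => hpre (hf.pre_of_pre ht hp h)⟩, hp⟩

theorem separatesMarking_fire (hf : IsMorphism N N' f) (ht : f.φT t = some t')
    (hsep : SeparatesMarking f.φP m) (hen : N.Enabled m t) (hm : ∀ p, m p ≤ 1)
    (hsafe : ∀ p', N'.fire (imageMarking f.φP m) t' p' ≤ 1) :
    SeparatesMarking f.φP (N.fire m t) := by
  have post (p : P) (p' : P') (hmp : 1 ≤ N.fire m t p) (hp : f.φP p p')
      (hpost : N'.flowTP t' p') : N.flowTP t p := by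
    by_contra htp
    obtain ⟨hmp, hpre⟩ := (PetriNet.one_le_fire_iff_of_not_post (hm p) htp).1 hmp
    exact hpre <| hf.pre_of_pre_image ht hsep hen hp hmp <|
      PetriNet.pre_of_post_of_fire_le_one (hsafe p')
        (one_le_imageMarking_iff.2 ⟨p, hmp, hp⟩) hpost
  intro p q p' hmp hmq hp hq
  by_cases hpost : N'.flowTP t' p'
  · exact (hf.post_trans t t' ht p' hpost).unique
      ⟨post p p' hmp hp hpost, hp⟩ ⟨post q p' hmq hq hpost, hq⟩
  · have marked (r : P) (hr : f.φP r p') (hmr : 1 ≤ N.fire m t r) : 1 ≤ m r :=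
      ((PetriNet.one_le_fire_iff_of_not_post (hm r)
        fun h => hpost (hf.post_of_post ht hr h)).1 hmr).1
    exact hsep p q p' (marked p hp hmp) (marked q hq hmq) hp hq

theorem separatesMarking_init (hf : IsMorphism N N' f) (hsafe : N.Safe)
    (hinit : imageMarking f.φP N.init = N'.init) : SeparatesMarking f.φP N.init := by
  have eq_one (p : P) (hp : 1 ≤ N.init p) : N.init p = 1 :=
    le_antisymm (hsafe _ (.refl _) p) hp
  intro p q p' hmp hmq hp hq
  refine (hf.init_unique p' ?_).unique ⟨eq_one p hmp, hp⟩ ⟨eq_one q hmq, hq⟩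
  rw [← hinit]
  exact le_antisymm (imageMarking_le_one _ _ _) (one_le_imageMarking_iff.2 ⟨p, hmp, hp⟩)

end IsMorphism

/-- if `m` is reachable in `N` by a firing sequence all of whose
transitions have a defined image under `φ_T`, then `φ_P(m)` is reachable in `N'`. -/
theorem stmt_1 {P T L P' T' L' : Type}
    (N : PetriNet P T L) (N' : PetriNet P' T' L')
    (hproper : N.Proper) (hproper' : N'.Proper)
    (hsafe : N.Safe) (hsafe' : N'.Safe)
    (f : NetMap P T L P' T' L') (hf : IsMorphism N N' f)
    (hinit : imageMarking f.φP N.init = N'.init)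
    (m : P → ℕ) (hm : ReachableDef N f.φT m) :
    N'.Reachable (imageMarking f.φP m) := by
  suffices h : SeparatesMarking f.φP m ∧ N'.Reachable (imageMarking f.φP m) from h.2
  induction hm with
  | init => exact ⟨hf.separatesMarking_init hsafe hinit, hinit ▸ .refl _⟩
  | @step m _ t hm hfire hdef ih =>
    obtain ⟨hsep, hreach⟩ := ih
    obtain ⟨hen, rfl⟩ := hfire
    obtain ⟨t', ht⟩ := Option.isSome_iff_exists.1 hdef
    have hm_le := hsafe m hm.reachable
    have hreach' : N'.Reachable (N'.fire (imageMarking f.φP m) t') :=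
      .step t' hreach ⟨hf.enabled_imageMarking ht hen, rfl⟩
    have hle := hsafe' _ hreach'
    exact ⟨hf.separatesMarking_fire ht hsep hen hm_le hle,
      (hf.imageMarking_fire ht hsep hen hm_le hle).symm ▸ hreach'⟩
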